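/- arXiv:2408.10350 — 7 statements merged into one kernel-verified Lean document; each statement's English description precedes it below -/
import Mathlib

section
/- Let n ≥ 2, d ≥ 1, K ≥ 1, and let ρ be a density matrix on ℂ^d ⊗ ℂ^d. Suppose there exist dichotomic observables τ_1, …, τ_n on ℂ^d that pairwise anticommute (τ_y τ_{y'} + τ_{y'} τ_y = 0 for y ≠ y'), and dichotomic observables τ'_1, …, τ'_K on ℂ^d that pairwise anticommute, such that the real number S := Σ_{y=1}^n Σ_{v=1}^K (Tr[(τ_y ⊗ τ'_v) ρ])² satisfies 2^{n−1}·√S > L_n. Then ρ violates the n-settings Bell inequality: there exist dichotomic observables A_1, …, A_{2^{n−1}} and B_1, …, B_n on ℂ^d such that 𝓘_n(A, B, ρ) > L_n. -/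
open Matrix Kronecker BigOperators
open scoped ComplexOrder

noncomputable section

/-- A dichotomic observable: a Hermitian matrix squaring to the identity. -/
def IsDichotomic {I : Type} [Fintype I] [DecidableEq I] (O : Matrix I I ℂ) : Prop :=
  O.IsHermitian ∧ O * O = 1

/-- A density matrix: positive semidefinite with trace one. -/
def IsDensity {I : Type} [Fintype I] [DecidableEq I] (ρ : Matrix I I ℂ) : Prop :=
  ρ.PosSemidef ∧ ρ.trace = 1

/-- The sign `(-1)^{z_y^x}`, where `z_y^x` is the bit in position `n - y`
(here `y : Fin n` represents the setting `y+1`, `x : Fin (2^(n-1))` represents `x+1`,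
so the bit is that of `x` in position `n - 1 - y`). -/
def bellSign (n : ℕ) (y : Fin n) (x : Fin (2 ^ (n - 1))) : ℝ :=
  if (x : ℕ).testBit (n - 1 - (y : ℕ)) then -1 else 1

/-- The Bell value `𝓘_n(A, B, ρ) = Σ_y Σ_x (-1)^{z_y^x} Tr[(A_x ⊗ B_y) ρ]`. -/
def bellValue (n : ℕ) {IA IB : Type} [Fintype IA] [Fintype IB]
    (A : Fin (2 ^ (n - 1)) → Matrix IA IA ℂ) (B : Fin n → Matrix IB IB ℂ)
    (ρ : Matrix (IA × IB) (IA × IB) ℂ) : ℝ :=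
  ∑ y : Fin n, ∑ x : Fin (2 ^ (n - 1)), bellSign n y x * (((A x ⊗ₖ B y) * ρ).trace).re

/-- The local bound `L_n = (⌊n/2⌋+1)·C(n, ⌊n/2⌋+1)`. -/
def localBound (n : ℕ) : ℝ := ((n / 2 + 1) * Nat.choose n (n / 2 + 1) : ℕ)

/-- A unit real combination of pairwise anticommuting dichotomic observables is dichotomic. -/
theorem IsDichotomic.sum_smul {I ι : Type} [Fintype I] [DecidableEq I] [Fintype ι]
    {τ : ι → Matrix I I ℂ} (hτ : ∀ i, IsDichotomic (τ i))
    (hac : ∀ i j, i ≠ j → τ i * τ j + τ j * τ i = 0)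
    {a : ι → ℝ} (ha : ∑ i, a i ^ 2 = 1) :
    IsDichotomic (∑ i, a i • τ i) := by
  classical
  refine ⟨?_, ?_⟩
  · simp only [Matrix.IsHermitian, conjTranspose_sum, conjTranspose_smul, star_trivial]
    exact Finset.sum_congr rfl fun i _ => by rw [(hτ i).1.eq]
  · have expand : (∑ i, a i • τ i) * (∑ i, a i • τ i)
        = ∑ i, ∑ j, (a i * a j) • (τ i * τ j) := by
      simp only [Finset.sum_mul_sum, smul_mul_smul_comm]
    have expand' : (∑ i, a i • τ i) * (∑ i, a i • τ i)
        = ∑ i, ∑ j, (a i * a j) • (τ j * τ i) := by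
      rw [expand, Finset.sum_comm]
      exact Finset.sum_congr rfl fun i _ => Finset.sum_congr rfl fun j _ => by
        rw [mul_comm (a j)]
    have double : (2 : ℝ) • ((∑ i, a i • τ i) * (∑ i, a i • τ i))
        = (2 : ℝ) • (1 : Matrix I I ℂ) := by
      calc (2 : ℝ) • ((∑ i, a i • τ i) * (∑ i, a i • τ i))
          = ∑ i, ∑ j, (a i * a j) • (τ i * τ j + τ j * τ i) := by
            rw [two_smul]
            nth_rewrite 1 [expand]
            rw [expand']
            simp only [smul_add, Finset.sum_add_distrib]
        _ = ∑ i, (2 * a i ^ 2) • (1 : Matrix I I ℂ) := by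
            refine Finset.sum_congr rfl fun i _ => ?_
            rw [Finset.sum_eq_single i (fun j _ hj => by rw [hac i j hj.symm, smul_zero])
              (by simp), (hτ i).2, ← two_smul ℝ, smul_smul]
            ring_nf
        _ = (2 : ℝ) • (1 : Matrix I I ℂ) := by
            rw [← Finset.sum_smul, ← Finset.mul_sum, ha, mul_one]
    exact smul_right_injective _ (two_ne_zero (α := ℝ)) double

theorem trace_sum_kronecker_sum_mul {I J ι κ : Type} [Fintype I] [Fintype J]
    [Fintype ι] [Fintype κ] (c : ι → ℝ) (d : κ → ℝ)
    (M : ι → Matrix I I ℂ) (P : κ → Matrix J J ℂ) (ρ : Matrix (I × J) (I × J) ℂ) :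
    ((((∑ i, c i • M i) ⊗ₖ (∑ j, d j • P j)) * ρ).trace).re
      = ∑ i, ∑ j, c i * d j * (((M i ⊗ₖ P j) * ρ).trace).re := by
  have h : (∑ i, c i • M i) ⊗ₖ (∑ j, d j • P j)
      = ∑ i, ∑ j, (c i * d j) • (M i ⊗ₖ P j) := by
    ext p q
    simp only [kroneckerMap_apply, Matrix.sum_apply, Matrix.smul_apply, Finset.sum_mul_sum,
      smul_mul_smul_comm]
  rw [h]
  simp only [Finset.sum_mul, trace_sum, Matrix.smul_mul, trace_smul, Complex.re_sum,
    Complex.smul_re, smul_eq_mul]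

theorem bellSign_mul_self (n : ℕ) (y : Fin n) (x : Fin (2 ^ (n - 1))) :
    bellSign n y x * bellSign n y x = 1 := by
  unfold bellSign; split_ifs <;> norm_num

/-- Flipping the bit attached to the larger setting negates the product of the two signs. -/
theorem sum_bellSign_mul_eq_zero_of_lt {n : ℕ} {y y' : Fin n} (h : y < y') :
    ∑ x, bellSign n y x * bellSign n y' x = 0 := by
  have hlt : (y : ℕ) < y' := h
  have hy' := y'.isLt
  let flip : Fin (2 ^ (n - 1)) → Fin (2 ^ (n - 1)) := fun x =>
    ⟨(x : ℕ) ^^^ 2 ^ (n - 1 - (y' : ℕ)), Nat.xor_lt_two_pow x.isLt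
      (Nat.pow_lt_pow_right (by norm_num) (by omega))⟩
  have flip_flip : Function.Involutive flip := fun x => by
    ext; simp [flip]
  have sign_y (x) : bellSign n y (flip x) = bellSign n y x := by
    have : n - 1 - (y' : ℕ) ≠ n - 1 - (y : ℕ) := by omega
    simp [bellSign, flip, Nat.testBit_xor, this]
  have sign_y' (x) : bellSign n y' (flip x) = -bellSign n y' x := by
    cases hb : (x : ℕ).testBit (n - 1 - (y' : ℕ)) <;>
      simp [bellSign, flip, Nat.testBit_xor, hb]
  have key := Equiv.sum_comp flip_flip.toPerm fun x => bellSign n y x * bellSign n y' x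
  simp only [Function.Involutive.coe_toPerm, sign_y, sign_y', mul_neg,
    Finset.sum_neg_distrib] at key
  linarith

theorem sum_bellSign_mul (n : ℕ) (y y' : Fin n) :
    ∑ x, bellSign n y x * bellSign n y' x = if y = y' then (2 : ℝ) ^ (n - 1) else 0 := by
  split_ifs with h
  · subst h
    simp [bellSign_mul_self]
  · rcases lt_or_gt_of_ne h with h | h
    · exact sum_bellSign_mul_eq_zero_of_lt h
    · simpa only [mul_comm] using sum_bellSign_mul_eq_zero_of_lt h

theorem bellValue_sum_smul (n : ℕ) {I J κ : Type} [Fintype I] [Fintype J] [Fintype κ]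
    (τ : Fin n → Matrix I I ℂ) (τ' : κ → Matrix J J ℂ) (ρ : Matrix (I × J) (I × J) ℂ)
    (a : Fin n → ℝ) (b : Fin n → κ → ℝ) :
    bellValue n (fun x => ∑ y, (bellSign n y x * a y) • τ y) (fun y => ∑ v, b y v • τ' v) ρ
      = 2 ^ (n - 1) * ∑ y, a y * ∑ v, b y v * (((τ y ⊗ₖ τ' v) * ρ).trace).re := by
  simp only [bellValue, trace_sum_kronecker_sum_mul]
  rw [Finset.mul_sum]
  refine Finset.sum_congr rfl fun y _ => ?_
  calc _ = ∑ z, (∑ x, bellSign n y x * bellSign n z x) *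
        (a z * ∑ v, b y v * (((τ z ⊗ₖ τ' v) * ρ).trace).re) := by
        simp only [Finset.mul_sum, Finset.sum_mul]
        rw [Finset.sum_comm]
        refine Finset.sum_congr rfl fun z _ => ?_
        rw [Finset.sum_comm]
        refine Finset.sum_congr rfl fun v _ => Finset.sum_congr rfl fun x _ => ?_
        ring
    _ = _ := by simp [sum_bellSign_mul]

theorem exists_unit_sum_mul_eq_sqrt {κ : Type} [Fintype κ] [Nonempty κ] (t : κ → ℝ) :
    ∃ b : κ → ℝ, ∑ v, b v ^ 2 = 1 ∧ ∑ v, b v * t v = Real.sqrt (∑ v, t v ^ 2) := by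
  classical
  have hnn : 0 ≤ ∑ v, t v ^ 2 := Finset.sum_nonneg fun v _ => sq_nonneg _
  rcases hnn.eq_or_lt with h | h
  · have ht : ∀ v, t v = 0 := fun v => by
      simpa using (Finset.sum_eq_zero_iff_of_nonneg fun v _ => sq_nonneg (t v)).1 h.symm v
        (Finset.mem_univ v)
    refine ⟨Pi.single (Classical.arbitrary κ) 1, ?_, ?_⟩
    · simp [Pi.single_apply, ite_pow]
    · simp [ht]
  · have hs := Real.sqrt_pos.2 h
    refine ⟨fun v => t v / Real.sqrt (∑ v, t v ^ 2), ?_, ?_⟩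
    · simp only [div_pow, ← Finset.sum_div, Real.sq_sqrt hnn, div_self h.ne']
    · simp only [div_mul_eq_mul_div, ← Finset.sum_div, ← sq, Real.div_sqrt]

/-- if there are `n` pairwise anticommuting dichotomic observables `τ` and `K`
pairwise anticommuting dichotomic observables `τ'` on `ℂ^d` with
`2^{n-1}·√(Σ_{y,v} Tr[(τ_y ⊗ τ'_v) ρ]²) > L_n`, then `ρ` violates the `n`-settings
Bell inequality. -/
theorem violation_of_sufficient_criterion
    (n d K : ℕ) (hn : 2 ≤ n) (hd : 1 ≤ d) (hK : 1 ≤ K)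
    (ρ : Matrix (Fin d × Fin d) (Fin d × Fin d) ℂ) (hρ : IsDensity ρ)
    (τ : Fin n → Matrix (Fin d) (Fin d) ℂ) (hτ : ∀ y, IsDichotomic (τ y))
    (hτac : ∀ y y', y ≠ y' → τ y * τ y' + τ y' * τ y = 0)
    (τ' : Fin K → Matrix (Fin d) (Fin d) ℂ) (hτ' : ∀ v, IsDichotomic (τ' v))
    (hτ'ac : ∀ v v', v ≠ v' → τ' v * τ' v' + τ' v' * τ' v = 0)
    (hS : (2 : ℝ) ^ (n - 1) *
        Real.sqrt (∑ y : Fin n, ∑ v : Fin K, ((((τ y ⊗ₖ τ' v) * ρ).trace).re) ^ 2)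
      > localBound n) :
    ∃ (A : Fin (2 ^ (n - 1)) → Matrix (Fin d) (Fin d) ℂ)
      (B : Fin n → Matrix (Fin d) (Fin d) ℂ),
      (∀ x, IsDichotomic (A x)) ∧ (∀ y, IsDichotomic (B y)) ∧
      bellValue n A B ρ > localBound n := by
  have : Nonempty (Fin K) := ⟨⟨0, hK⟩⟩
  have : Nonempty (Fin n) := ⟨⟨0, by omega⟩⟩
  choose b hb hbt using fun y : Fin n =>
    exists_unit_sum_mul_eq_sqrt fun v : Fin K => (((τ y ⊗ₖ τ' v) * ρ).trace).re
  obtain ⟨a, ha, hat⟩ := exists_unit_sum_mul_eq_sqrt fun y : Fin n =>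
    Real.sqrt (∑ v : Fin K, ((((τ y ⊗ₖ τ' v) * ρ).trace).re) ^ 2)
  refine ⟨fun x => ∑ y, (bellSign n y x * a y) • τ y, fun y => ∑ v, b y v • τ' v,
    fun x => IsDichotomic.sum_smul hτ hτac ?_,
    fun y => IsDichotomic.sum_smul hτ' hτ'ac (hb y), ?_⟩
  · simpa only [mul_pow, sq (bellSign _ _ _), bellSign_mul_self, one_mul] using ha
  · rw [bellValue_sum_smul]
    simp only [hbt, hat]
    simpa only [Real.sq_sqrt (Finset.sum_nonneg fun v _ => sq_nonneg _)] using hS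
end
end

section
/- Let n ≥ 2 and let C_1, …, C_n be d×d complex matrices. Suppose there is a d×d matrix D such that for every x ∈ {1,…,2^{n−1}}, (Σ_{y=1}^n (−1)^{z_y^x} C_y)² = D, i.e., all 2^{n−1} sign-combinations of the C_y determined by the bit patterns z have the same square. Then the C_y pairwise anticommute: C_y C_{y'} + C_{y'} C_y = 0 for all y ≠ y' in {1,…,n}. -/
open Matrix Kronecker BigOperators
open scoped ComplexOrder

noncomputable section

/-- Up to a global sign, every sign vector on `Fin n` is of the form `fun y => bellSign n y x`. -/
theorem exists_bellSign_eq (n : ℕ) (hn : 0 < n) (s : Fin n → Bool) :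
    ∃ x : Fin (2 ^ (n - 1)), ∀ y : Fin n,
      bellSign n y x = (if s ⟨0, hn⟩ then -1 else 1) * (if s y then -1 else 1) := by
  refine ⟨⟨Nat.ofBits fun i : Fin (n - 1) =>
    (s ⟨n - 1 - i, by omega⟩ ^^ s ⟨0, hn⟩), Nat.ofBits_lt_two_pow _⟩, fun y => ?_⟩
  obtain ⟨y, hy⟩ := y
  unfold bellSign
  rcases Nat.eq_zero_or_pos y with rfl | hpos
  · rw [Nat.testBit_ofBits_ge _ _ (by simp)]
    cases s ⟨0, hn⟩ <;> simp
  · have hlt : n - 1 - y < n - 1 := by omega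
    have hsub : n - 1 - (n - 1 - y) = y := by omega
    rw [Nat.testBit_ofBits_lt _ _ hlt]
    simp only [hsub]
    cases s ⟨0, hn⟩ <;> cases s ⟨y, hy⟩ <;> simp

/-- If the squares `(Σ_y (-1)^{z_y^x} C_y)²` all coincide, then so do the squares of all
sign combinations of the `C_y`. -/
theorem sq_sum_signs_eq {n d : ℕ} (hn : 0 < n)
    {C : Fin n → Matrix (Fin d) (Fin d) ℂ} {D : Matrix (Fin d) (Fin d) ℂ}
    (hsq : ∀ x : Fin (2 ^ (n - 1)), (∑ y : Fin n, (bellSign n y x : ℂ) • C y) ^ 2 = D)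
    (s : Fin n → Bool) :
    (∑ y : Fin n, (if s y then -C y else C y)) ^ 2 = D := by
  obtain ⟨x, hx⟩ := exists_bellSign_eq n hn s
  rw [← hsq x]
  simp only [hx]
  cases s ⟨0, hn⟩
  · congr 1
    refine Finset.sum_congr rfl fun y _ => ?_
    cases s y <;> simp
  · rw [← neg_sq, ← Finset.sum_neg_distrib]
    congr 1
    refine Finset.sum_congr rfl fun y _ => ?_
    cases s y <;> simp

/-- if all `2^{n-1}` sign-combinations `(Σ_y (-1)^{z_y^x} C_y)²` coincide
(equal to a fixed matrix `D`), then the `C_y` pairwise anticommute. -/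
theorem anticommuting_of_equal_squares
    (n d : ℕ) (hn : 2 ≤ n)
    (C : Fin n → Matrix (Fin d) (Fin d) ℂ) (D : Matrix (Fin d) (Fin d) ℂ)
    (hsq : ∀ x : Fin (2 ^ (n - 1)),
      (∑ y : Fin n, (bellSign n y x : ℂ) • C y) ^ 2 = D) :
    ∀ y y' : Fin n, y ≠ y' → C y * C y' + C y' * C y = 0 := by
  intro a b hab
  have hsplit (p q : Bool) :
      ((if p then -C a else C a) + ((if q then -C b else C b) +
        ∑ y ∈ (Finset.univ.erase a).erase b, C y)) ^ 2 = D := by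
    rw [← sq_sum_signs_eq (by omega) hsq fun y => if y = a then p else if y = b then q else false,
      ← Finset.add_sum_erase _ _ (Finset.mem_univ a),
      ← Finset.add_sum_erase _ _ (Finset.mem_erase.2 ⟨hab.symm, Finset.mem_univ b⟩)]
    have hrest : ∑ y ∈ (Finset.univ.erase a).erase b, C y =
        ∑ y ∈ (Finset.univ.erase a).erase b,
          (if (if y = a then p else if y = b then q else false) then -C y else C y) := by
      refine Finset.sum_congr rfl fun y hy => ?_
      simp only [Finset.mem_erase, Finset.mem_univ, and_true] at hy
      simp [hy.1, hy.2]
    rw [hrest]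
    simp [hab.symm]
  generalize ∑ y ∈ (Finset.univ.erase a).erase b, C y = T at hsplit
  have h₁ := hsplit false false
  have h₂ := hsplit true true
  have h₃ := hsplit true false
  have h₄ := hsplit false true
  simp only [if_true, Bool.false_eq_true, if_false] at h₁ h₂ h₃ h₄
  have hpolar : (4 : ℂ) • (C a * C b + C b * C a) =
      (C a + (C b + T)) ^ 2 + (-C a + (-C b + T)) ^ 2
        - (-C a + (C b + T)) ^ 2 - (C a + (-C b + T)) ^ 2 := by
    rw [ofNat_smul_eq_nsmul]
    noncomm_ring
  rw [h₁, h₂, h₃, h₄, add_sub_cancel_right, sub_self] at hpolar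
  exact (smul_eq_zero.1 hpolar).resolve_left four_ne_zero
end
end

section
/- Let n ≥ 1, d ≥ 1, and let A_0, A_1, …, A_{2^{n−1}−1} be d×d complex matrices with A_k² = I for every k. For each s ∈ {0, 1, …, 2^{n−1}−1} define A'_s = Σ_{k=0}^{2^{n−1}−1} (−1)^{popcount(s AND k)} A_k, where AND is bitwise conjunction of the natural numbers s and k and popcount counts the number of ones in binary. Then Σ_{s=0}^{2^{n−1}−1} (A'_s)² = 4^{n−1}·I. -/
open Matrix Kronecker BigOperators
open scoped ComplexOrder

noncomputable section

/-- `popcount m`: the number of ones in the binary expansion of `m`. -/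
def popcount (m : ℕ) : ℕ := (Nat.digits 2 m).sum

theorem popcount_bit (b : Bool) (m : ℕ) : popcount (Nat.bit b m) = b.toNat + popcount m := by
  unfold popcount
  cases b
  · rcases Nat.eq_zero_or_pos m with rfl | h
    · simp
    · simp [Nat.bit, Nat.digits_def' one_lt_two (show 0 < 2 * m by omega)]
  · simp [Nat.bit, Nat.mul_add_div]

theorem walsh_sign_bit (a b : Bool) (s k : ℕ) :
    (-1 : ℂ) ^ popcount (Nat.bit a s &&& Nat.bit b k)
      = (-1) ^ (a && b).toNat * (-1) ^ popcount (s &&& k) := by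
  rw [Nat.land_bit, popcount_bit, pow_add]

theorem sum_range_two_pow_succ (m : ℕ) (f : ℕ → ℂ) :
    ∑ s ∈ Finset.range (2 ^ (m + 1)), f s
      = ∑ s ∈ Finset.range (2 ^ m), (f (Nat.bit false s) + f (Nat.bit true s)) := by
  rw [pow_succ']
  induction 2 ^ m with
  | zero => simp
  | succ N ih =>
    rw [Nat.mul_succ, Finset.sum_range_succ, Finset.sum_range_succ, ih, Finset.sum_range_succ]
    simp [Nat.bit, add_assoc]

/-- The rows of the Walsh–Hadamard sign matrix are orthogonal. -/
theorem walsh_sign_orthogonality (m k l : ℕ) (hk : k < 2 ^ m) (hl : l < 2 ^ m) :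
    ∑ s ∈ Finset.range (2 ^ m),
        (-1 : ℂ) ^ popcount (s &&& k) * (-1) ^ popcount (s &&& l)
      = if k = l then 2 ^ m else 0 := by
  induction m generalizing k l with
  | zero =>
    obtain rfl : k = 0 := by simpa using hk
    obtain rfl : l = 0 := by simpa using hl
    simp [popcount]
  | succ m ih =>
    induction k using Nat.bitCasesOn with | bit b k
    induction l using Nat.bitCasesOn with | bit c l
    have hk' : k < 2 ^ m := by
      cases b <;> simp only [Nat.bit, cond_true, cond_false] at hk <;> omega
    have hl' : l < 2 ^ m := by
      cases c <;> simp only [Nat.bit, cond_true, cond_false] at hl <;> omega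
    rw [sum_range_two_pow_succ]
    have key := ih k l hk' hl'
    have hsum : ∀ s ∈ Finset.range (2 ^ m),
        (-1 : ℂ) ^ popcount (Nat.bit false s &&& Nat.bit b k)
            * (-1) ^ popcount (Nat.bit false s &&& Nat.bit c l)
          + (-1) ^ popcount (Nat.bit true s &&& Nat.bit b k)
            * (-1) ^ popcount (Nat.bit true s &&& Nat.bit c l)
        = (1 + (-1) ^ b.toNat * (-1) ^ c.toNat)
            * ((-1) ^ popcount (s &&& k) * (-1) ^ popcount (s &&& l)) := by
      intro s _
      simp only [walsh_sign_bit, Bool.false_and, Bool.true_and, Bool.toNat_false, pow_zero]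
      ring
    rw [Finset.sum_congr rfl hsum, ← Finset.mul_sum, key]
    cases b <;> cases c <;> simp [Nat.bit, pow_succ'] <;> first | omega | norm_num

/-- for matrices `A_k` with `A_k² = I` and the Walsh–Hadamard combinations
`A'_s = Σ_k (-1)^{popcount(s AND k)} A_k`, one has `Σ_s (A'_s)² = 4^{n-1}·I`. -/
theorem walsh_hadamard_square_sum
    (n d : ℕ) (hn : 1 ≤ n) (hd : 1 ≤ d)
    (A : Fin (2 ^ (n - 1)) → Matrix (Fin d) (Fin d) ℂ)
    (hA : ∀ k, A k * A k = 1) :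
    ∑ s : Fin (2 ^ (n - 1)),
        (∑ k : Fin (2 ^ (n - 1)),
          ((-1 : ℂ) ^ popcount ((s : ℕ) &&& (k : ℕ))) • A k) ^ 2
      = ((4 : ℂ) ^ (n - 1)) • (1 : Matrix (Fin d) (Fin d) ℂ) := by
  have horth : ∀ k l : Fin (2 ^ (n - 1)),
      ∑ s : Fin (2 ^ (n - 1)), (-1 : ℂ) ^ popcount ((s : ℕ) &&& (k : ℕ))
          * (-1) ^ popcount ((s : ℕ) &&& (l : ℕ))
        = if k = l then 2 ^ (n - 1) else 0 := by
    intro k l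
    rw [Fin.sum_univ_eq_sum_range (fun s => (-1 : ℂ) ^ popcount (s &&& (k : ℕ))
      * (-1) ^ popcount (s &&& (l : ℕ))), walsh_sign_orthogonality _ _ _ k.2 l.2]
    simp only [Fin.ext_iff]
  simp only [sq, Finset.sum_mul_sum, smul_mul_smul_comm]
  rw [Finset.sum_comm]
  simp_rw [Finset.sum_comm (s := Finset.univ) (t := Finset.univ)
    (f := fun (s l : Fin (2 ^ (n - 1))) => (_ : ℂ) • (A _ * A l)), ← Finset.sum_smul, horth]
  simp only [ite_smul, zero_smul, Finset.sum_ite_eq, Finset.mem_univ, if_true, hA,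
    Finset.sum_const, Finset.card_univ, Fintype.card_fin]
  rw [← Nat.cast_smul_eq_nsmul ℂ, smul_smul]
  congr 1
  push_cast
  rw [← mul_pow]
  norm_num
end
end

section
/- Let n ≥ 2. For each pair (y, y') with 1 ≤ y < y' ≤ n define the vector v_{y,y'} : {1, …, 2^{n−1}−1} → ℚ by v_{y,y'}(j) = 1 if the bit in position n−y of j differs from the bit in position n−y' of j, and v_{y,y'}(j) = 0 otherwise. Then these n(n−1)/2 vectors are linearly independent over ℚ. -/
open BigOperators

/-- the `n(n-1)/2` vectors `v_{y,y'} : {1,…,2^{n-1}-1} → ℚ`, where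
`v_{y,y'}(j) = 1` if the bit of `j` in position `n-y` differs from the bit of `j` in
position `n-y'` and `0` otherwise, are linearly independent over `ℚ`.
Here a pair `(y, y')` with `1 ≤ y < y' ≤ n` is encoded as `p : Fin n × Fin n` with
`p.1 < p.2` (so `y = p.1 + 1`, `y' = p.2 + 1`, and the bit positions are
`n - 1 - p.1` and `n - 1 - p.2`), and `j ∈ {1,…,2^{n-1}-1}` is encoded as
`j : Fin (2^{n-1} - 1)` representing `j + 1`. -/
theorem xor_vectors_linearIndependent (n : ℕ) (hn : 2 ≤ n) :
    LinearIndependent ℚ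
      (fun p : {p : Fin n × Fin n // p.1 < p.2} =>
        (fun j : Fin (2 ^ (n - 1) - 1) =>
          if ((j : ℕ) + 1).testBit (n - 1 - (p.1.1 : ℕ))
              ≠ ((j : ℕ) + 1).testBit (n - 1 - (p.1.2 : ℕ))
          then (1 : ℚ) else 0)) := by
  rw [Fintype.linearIndependent_iff]
  intro g hg
  have eval_eq_zero (k : ℕ) (hk : k ≠ 0) (hkn : k < 2 ^ (n - 1)) :
      ∑ p : {p : Fin n × Fin n // p.1 < p.2}, g p *
        (if k.testBit (n - 1 - (p.1.1 : ℕ)) ≠ k.testBit (n - 1 - (p.1.2 : ℕ))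
          then (1 : ℚ) else 0) = 0 := by
    have h := congrFun hg ⟨k - 1, by omega⟩
    simpa only [Finset.sum_apply, Pi.smul_apply, smul_eq_mul, Pi.zero_apply,
      Nat.sub_add_cancel (Nat.one_le_iff_ne_zero.mpr hk)] using h
  have testBit_pow (s p : Fin n) :
      (2 ^ (n - 1 - (s : ℕ))).testBit (n - 1 - (p : ℕ)) = decide (p = s) := by
    rw [Nat.testBit_two_pow, decide_eq_decide]
    omega
  have pow_lt (s : Fin n) (hs : 0 < (s : ℕ)) : 2 ^ (n - 1 - (s : ℕ)) < 2 ^ (n - 1) :=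
    Nat.pow_lt_pow_right (by norm_num) (by omega)
  have pow_ne (s : Fin n) : 2 ^ (n - 1 - (s : ℕ)) ≠ 0 := by positivity
  -- Inclusion-exclusion on two bits isolates a pair of positions below `n - 1`.
  have coeff_of_pos (i : {p : Fin n × Fin n // p.1 < p.2}) (hi : 0 < (i.1.1 : ℕ)) :
      g i = 0 := by
    obtain ⟨⟨s, t⟩, hst⟩ := i
    dsimp only at hst hi
    have ht : 0 < (t : ℕ) := hi.trans hst
    have hs₀ := eval_eq_zero _ (pow_ne s) (pow_lt s hi)
    have ht₀ := eval_eq_zero _ (pow_ne t) (pow_lt t ht)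
    have hst₀ := eval_eq_zero (2 ^ (n - 1 - (s : ℕ)) ||| 2 ^ (n - 1 - (t : ℕ)))
      (by simp [Nat.or_eq_zero_iff]) (Nat.or_lt_two_pow (pow_lt s hi) (pow_lt t ht))
    simp only [Nat.testBit_or, testBit_pow] at hs₀ ht₀ hst₀
    have h : ∑ p : {p : Fin n × Fin n // p.1 < p.2},
        g p * (if p = ⟨(s, t), hst⟩ then (2 : ℚ) else 0) = 0 := by
      have e := congrArg₂ (· - ·) (congrArg₂ (· + ·) hs₀ ht₀) hst₀
      simp only [← Finset.sum_add_distrib, ← Finset.sum_sub_distrib, add_zero, sub_zero] at e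
      refine (Finset.sum_congr rfl fun p _ => ?_).trans e
      obtain ⟨⟨a, b⟩, hab⟩ := p
      dsimp only at hab
      rw [← mul_add, ← mul_sub]
      congr 1
      simp only [Subtype.mk.injEq, Prod.mk.injEq]
      by_cases h₁ : a = s <;> by_cases h₂ : b = t <;> by_cases h₃ : a = t <;>
        by_cases h₄ : b = s <;> first
          | omega
          | norm_num [h₁, h₂, h₃, h₄, hst.ne, hst.ne']
    simpa using h
  intro i
  by_cases hi : 0 < (i.1.1 : ℕ)
  · exact coeff_of_pos i hi
  obtain ⟨⟨s, t⟩, hst⟩ := i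
  dsimp only at hst hi
  have ht₀ := eval_eq_zero _ (pow_ne t) (pow_lt t (by omega))
  simp only [testBit_pow] at ht₀
  rw [Finset.sum_eq_single ⟨(s, t), hst⟩] at ht₀
  · simpa [hst.ne] using ht₀
  · rintro ⟨⟨a, b⟩, hab⟩ - hne
    dsimp only at hab
    by_cases ha : 0 < (a : ℕ)
    · rw [coeff_of_pos ⟨(a, b), hab⟩ ha, zero_mul]
    · have has : a = s := by omega
      subst has
      have hbt : b ≠ t := fun h => hne (by subst h; rfl)
      simp [hbt, hst.ne]
  · simp
end

section
/- Let n ≥ 2, let ρ be a density matrix on ℂ^{d_A} ⊗ ℂ^{d_B}, let A_1, …, A_{2^{n−1}} be dichotomic observables on ℂ^{d_A} and B_1, …, B_n dichotomic observables on ℂ^{d_B}. Then 𝓘_n(A, B, ρ) ≤ 2^{n−1}·√n. -/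
open Matrix Kronecker BigOperators
open scoped ComplexOrder

noncomputable section

/-- Sign vectors of two distinct settings are orthogonal: flipping the bit that belongs to the
later setting reverses the sign of exactly one factor. -/
theorem sum_bellSign_mul_of_lt (n : ℕ) {y y' : Fin n} (h : y < y') :
    ∑ x, bellSign n y x * bellSign n y' x = 0 := by
  have hlt : (y : ℕ) < y' := h
  have hy' := y'.isLt
  have hk : n - 1 - (y' : ℕ) < n - 1 := by omega
  have hne : n - 1 - (y' : ℕ) ≠ n - 1 - (y : ℕ) := by omega
  have hpow : 2 ^ (n - 1 - (y' : ℕ)) < 2 ^ (n - 1) := Nat.pow_lt_pow_right (by norm_num) hk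
  let flip : Fin (2 ^ (n - 1)) → Fin (2 ^ (n - 1)) := fun x =>
    ⟨(x : ℕ) ^^^ 2 ^ (n - 1 - (y' : ℕ)), Nat.xor_lt_two_pow x.isLt hpow⟩
  have hsame : ∀ x, bellSign n y (flip x) = bellSign n y x := by
    intro x
    simp [bellSign, flip, Nat.testBit_xor, Nat.testBit_two_pow_of_ne hne]
  have hflip : ∀ x, bellSign n y' (flip x) = -bellSign n y' x := by
    intro x
    simp only [bellSign, flip, Nat.testBit_xor, Nat.testBit_two_pow_self]
    cases (x : ℕ).testBit (n - 1 - (y' : ℕ)) <;> simp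
  have hinv : Function.Involutive flip := by
    intro x
    apply Fin.ext
    simp [flip]
  have hsum := Equiv.sum_comp hinv.toPerm (fun x => bellSign n y x * bellSign n y' x)
  simp only [Function.Involutive.coe_toPerm, hsame, hflip, mul_neg, Finset.sum_neg_distrib] at hsum
  linarith

/-- The expectation value `Re Tr[M ρ]`, as a real-linear functional of `M`. -/
def expectation {I : Type} [Fintype I] (ρ : Matrix I I ℂ) : Matrix I I ℂ →ₗ[ℝ] ℝ :=
  Complex.reLm ∘ₗ Matrix.traceLinearMap I ℝ ℂ ∘ₗ LinearMap.mulRight ℝ ρ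

theorem expectation_apply {I : Type} [Fintype I] (ρ M : Matrix I I ℂ) :
    expectation ρ M = (M * ρ).trace.re := rfl

theorem expectation_conjTranspose_mul_self_nonneg {I : Type} [Fintype I] {ρ : Matrix I I ℂ}
    (hρ : ρ.PosSemidef) (M : Matrix I I ℂ) : 0 ≤ expectation ρ (Mᴴ * M) := by
  rw [expectation_apply, Matrix.mul_assoc, Matrix.trace_mul_comm]
  exact (Complex.le_def.mp (hρ.mul_mul_conjTranspose_same M).trace_nonneg).1

/-- Arithmetic-geometric mean inequality for commuting Hermitian observables. -/
theorem two_mul_expectation_mul_le {I : Type} [Fintype I] {ρ P Q : Matrix I I ℂ}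
    (hρ : ρ.PosSemidef) (hP : P.IsHermitian) (hQ : Q.IsHermitian) (hPQ : Commute P Q) (c : ℝ) :
    2 * c * expectation ρ (P * Q) ≤ c ^ 2 * expectation ρ (P * P) + expectation ρ (Q * Q) := by
  have h := expectation_conjTranspose_mul_self_nonneg hρ (c • P - Q)
  have hexp : (c • P - Q)ᴴ * (c • P - Q)
      = c ^ 2 • (P * P) - (2 * c) • (P * Q) + Q * Q := by
    rw [conjTranspose_sub, conjTranspose_smul, hP.eq, hQ.eq, sub_mul, mul_sub, mul_sub,
      smul_mul_assoc, smul_mul_assoc, mul_smul_comm, mul_smul_comm, ← hPQ.eq, star_trivial]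
    module
  rw [hexp, map_add, map_sub, map_smul, map_smul, smul_eq_mul, smul_eq_mul] at h
  linarith

/-- The combination of the second party's observables paired with the setting `x`. -/
def signedSum (n : ℕ) {I : Type} (B : Fin n → Matrix I I ℂ) (x : Fin (2 ^ (n - 1))) :
    Matrix I I ℂ :=
  ∑ y, bellSign n y x • B y

theorem signedSum_isHermitian (n : ℕ) {I : Type} {B : Fin n → Matrix I I ℂ}
    (hB : ∀ y, (B y).IsHermitian) (x : Fin (2 ^ (n - 1))) : (signedSum n B x).IsHermitian := by
  simp [signedSum, Matrix.IsHermitian, conjTranspose_sum, conjTranspose_smul, (hB _).eq]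

theorem sum_signedSum_mul_self (n : ℕ) {I : Type} [Fintype I] [DecidableEq I]
    {B : Fin n → Matrix I I ℂ} (hB : ∀ y, B y * B y = 1) :
    ∑ x, signedSum n B x * signedSum n B x = ((2 : ℝ) ^ (n - 1) * n) • (1 : Matrix I I ℂ) := by
  calc ∑ x, signedSum n B x * signedSum n B x
      = ∑ x, ∑ y, ∑ y', (bellSign n y x * bellSign n y' x) • (B y * B y') := by
        simp only [signedSum, Finset.sum_mul_sum, smul_mul_smul_comm]
    _ = ∑ y, ∑ y', (∑ x, bellSign n y x * bellSign n y' x) • (B y * B y') := by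
        rw [Finset.sum_comm]
        refine Finset.sum_congr rfl fun y _ => ?_
        rw [Finset.sum_comm]
        simp only [Finset.sum_smul]
    _ = ((2 : ℝ) ^ (n - 1) * n) • (1 : Matrix I I ℂ) := by
        simp only [sum_bellSign_mul, ite_smul, zero_smul, Finset.sum_ite_eq, Finset.mem_univ,
          if_true, hB, Finset.sum_const, Finset.card_univ, Fintype.card_fin]
        rw [← Nat.cast_smul_eq_nsmul ℝ, smul_smul, mul_comm]

theorem kronecker_finset_sum {ι l m p q : Type} (s : Finset ι) (M : Matrix l m ℂ)
    (f : ι → Matrix p q ℂ) : M ⊗ₖ (∑ i ∈ s, f i) = ∑ i ∈ s, M ⊗ₖ f i := by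
  ext
  simp [kroneckerMap_apply, Matrix.sum_apply, Finset.mul_sum]

theorem bellValue_eq_sum_expectation (n : ℕ) {IA IB : Type} [Fintype IA] [Fintype IB]
    [DecidableEq IA] [DecidableEq IB]
    (A : Fin (2 ^ (n - 1)) → Matrix IA IA ℂ) (B : Fin n → Matrix IB IB ℂ)
    (ρ : Matrix (IA × IB) (IA × IB) ℂ) :
    bellValue n A B ρ
      = ∑ x, expectation ρ ((A x ⊗ₖ (1 : Matrix IB IB ℂ)) *
          ((1 : Matrix IA IA ℂ) ⊗ₖ signedSum n B x)) := by
  have hsum : ∀ x, A x ⊗ₖ signedSum n B x = ∑ y, bellSign n y x • (A x ⊗ₖ B y) := by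
    intro x
    simp only [signedSum, kronecker_finset_sum, kronecker_smul]
  simp only [← mul_kronecker_mul, mul_one, one_mul, hsum, map_sum, map_smul, smul_eq_mul,
    expectation_apply, bellValue]
  exact Finset.sum_comm

/-- the Tsirelson-type bound `𝓘_n(A, B, ρ) ≤ 2^{n-1}·√n` for all
dichotomic observables and any density matrix. -/
theorem bell_value_quantum_bound
    (n dA dB : ℕ) (hn : 2 ≤ n)
    (ρ : Matrix (Fin dA × Fin dB) (Fin dA × Fin dB) ℂ) (hρ : IsDensity ρ)
    (A : Fin (2 ^ (n - 1)) → Matrix (Fin dA) (Fin dA) ℂ)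
    (hA : ∀ x, IsDichotomic (A x))
    (B : Fin n → Matrix (Fin dB) (Fin dB) ℂ)
    (hB : ∀ y, IsDichotomic (B y)) :
    bellValue n A B ρ ≤ (2 : ℝ) ^ (n - 1) * Real.sqrt n := by
  have hn0 : (0 : ℝ) < n := by exact_mod_cast (by omega : 0 < n)
  set P := fun x => A x ⊗ₖ (1 : Matrix (Fin dB) (Fin dB) ℂ) with hPdef
  set Q := fun x => (1 : Matrix (Fin dA) (Fin dA) ℂ) ⊗ₖ signedSum n B x with hQdef
  have hone : expectation ρ 1 = 1 := by simp [expectation_apply, hρ.2]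
  have hPP : ∀ x, P x * P x = 1 := fun x => by
    simp [hPdef, ← mul_kronecker_mul, (hA x).2]
  have hQQ : ∑ x, Q x * Q x = ((2 : ℝ) ^ (n - 1) * n) • 1 := by
    simp only [hQdef, ← mul_kronecker_mul, mul_one]
    rw [← kronecker_finset_sum, sum_signedSum_mul_self n fun y => (hB y).2, kronecker_smul,
      one_kronecker_one]
  have hle : ∀ x, 2 * √n * expectation ρ (P x * Q x) ≤ n + expectation ρ (Q x * Q x) := by
    intro x
    have hP : (P x).IsHermitian := by
      simp [hPdef, Matrix.IsHermitian, conjTranspose_kronecker, (hA x).1.eq]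
    have hQ : (Q x).IsHermitian := by
      simp [hQdef, Matrix.IsHermitian, conjTranspose_kronecker,
        (signedSum_isHermitian n (fun y => (hB y).1) x).eq]
    have hPQ : Commute (P x) (Q x) := by
      simp [hPdef, hQdef, Commute, SemiconjBy, ← mul_kronecker_mul]
    have h := two_mul_expectation_mul_le hρ.1 hP hQ hPQ (√n)
    rwa [hPP, hone, mul_one, Real.sq_sqrt hn0.le] at h
  have hsum := Finset.sum_le_sum fun x (_ : x ∈ Finset.univ) => hle x
  rw [← Finset.mul_sum, Finset.sum_add_distrib,
    ← map_sum (expectation ρ) (fun x => Q x * Q x), hQQ, map_smul, hone] at hsum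
  rw [bellValue_eq_sum_expectation]
  have hsqrt := Real.mul_self_sqrt hn0.le
  refine le_of_mul_le_mul_left (hsum.trans_eq ?_) (by positivity : 0 < 2 * √(n : ℝ))
  simp only [Finset.sum_const, Finset.card_univ, Fintype.card_fin, nsmul_eq_mul, smul_eq_mul,
    mul_one, Nat.cast_pow, Nat.cast_ofNat]
  linear_combination (-2 * (2 : ℝ) ^ (n - 1)) * hsqrt
end
end

section
/- Let ρ be a density matrix on ℂ² ⊗ ℂ² with correlation coefficients t_{ij} = Tr[(σ_i ⊗ σ_j) ρ] for i, j ∈ {1,2,3}, and assume t_{ij} ≠ 0 for at least one pair (i,j). Then there exist dichotomic observables A_1, A_2, A_3, A_4 and B_1, B_2, B_3 on ℂ² such that the elegant Bell value attains the bound: 𝓘_3(A, B, ρ) = 4·√(Σ_{i,j=1}^3 t_{ij}²). -/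
open Matrix Kronecker BigOperators
open scoped ComplexOrder

noncomputable section

/-- The three Pauli matrices `σ_1, σ_2, σ_3`. -/
def pauli : Fin 3 → Matrix (Fin 2) (Fin 2) ℂ :=
  ![!![0, 1; 1, 0], !![0, -Complex.I; Complex.I, 0], !![1, 0; 0, -1]]

/-- The correlation coefficients `t_{ij} = Tr[(σ_i ⊗ σ_j) ρ]` of a two-qubit state. -/
def corr (ρ : Matrix ((Fin 2) × (Fin 2)) ((Fin 2) × (Fin 2)) ℂ) (i j : Fin 3) : ℝ :=
  (((pauli i ⊗ₖ pauli j) * ρ).trace).re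

/-- The elegant Bell value `𝓘_3(A, B, ρ)`. -/
def elegantValue (A : Fin 4 → Matrix (Fin 2) (Fin 2) ℂ)
    (B : Fin 3 → Matrix (Fin 2) (Fin 2) ℂ)
    (ρ : Matrix ((Fin 2) × (Fin 2)) ((Fin 2) × (Fin 2)) ℂ) : ℝ :=
  ((((A 0 + A 1 + A 2 + A 3) ⊗ₖ B 0 + (A 0 + A 1 - A 2 - A 3) ⊗ₖ B 1 +
      (A 0 - A 1 + A 2 - A 3) ⊗ₖ B 2) * ρ).trace).re

/-- The qubit observable with Bloch vector `v`. -/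
def blochObservable (v : Fin 3 → ℝ) : Matrix (Fin 2) (Fin 2) ℂ :=
  ∑ i, (v i : ℂ) • pauli i

theorem blochObservable_add (u v : Fin 3 → ℝ) :
    blochObservable (u + v) = blochObservable u + blochObservable v := by
  simp [blochObservable, add_smul, Finset.sum_add_distrib]

theorem blochObservable_sub (u v : Fin 3 → ℝ) :
    blochObservable (u - v) = blochObservable u - blochObservable v := by
  simp [blochObservable, sub_smul, Finset.sum_sub_distrib]

theorem isDichotomic_blochObservable {v : Fin 3 → ℝ} (hv : v ⬝ᵥ v = 1) :
    IsDichotomic (blochObservable v) := by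
  have h : (v 0 : ℂ) * v 0 + v 1 * v 1 + v 2 * v 2 = 1 := by
    rw [dotProduct, Fin.sum_univ_three] at hv
    exact_mod_cast hv
  constructor
  · ext i j
    fin_cases i <;> fin_cases j <;>
      simp [blochObservable, pauli, Fin.sum_univ_three]
  · ext i j
    fin_cases i <;> fin_cases j <;>
      simp [blochObservable, pauli, Fin.sum_univ_three, Matrix.mul_apply] <;>
      first | ring1 | linear_combination h - (v 1 : ℂ) ^ 2 * Complex.I_sq

theorem trace_kronecker_blochObservable
    (ρ : Matrix ((Fin 2) × (Fin 2)) ((Fin 2) × (Fin 2)) ℂ) (u v : Fin 3 → ℝ) :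
    (((blochObservable u ⊗ₖ blochObservable v) * ρ).trace).re =
      u ⬝ᵥ (Matrix.of (corr ρ) *ᵥ v) := by
  have h : (blochObservable u ⊗ₖ blochObservable v) =
      ∑ i, ∑ j, ((u i * v j : ℝ) : ℂ) • (pauli i ⊗ₖ pauli j) := by
    ext ⟨a, b⟩ ⟨c, d⟩
    simp only [blochObservable, Matrix.kroneckerMap_apply, Matrix.sum_apply, Matrix.smul_apply,
      smul_eq_mul, Finset.sum_mul_sum]
    refine Finset.sum_congr rfl fun i _ => Finset.sum_congr rfl fun j _ => ?_
    push_cast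
    ring
  simp only [h, Finset.sum_mul, Matrix.smul_mul, Matrix.trace_sum, Matrix.trace_smul,
    smul_eq_mul, Complex.re_sum, Complex.re_ofReal_mul, dotProduct, mulVec, Finset.mul_sum,
    Matrix.of_apply, corr]
  exact Finset.sum_congr rfl fun i _ => Finset.sum_congr rfl fun j _ => by ring

theorem elegantValue_blochObservable
    (ρ : Matrix ((Fin 2) × (Fin 2)) ((Fin 2) × (Fin 2)) ℂ)
    (a : Fin 4 → Fin 3 → ℝ) (b : Fin 3 → Fin 3 → ℝ) :
    elegantValue (fun x => blochObservable (a x)) (fun y => blochObservable (b y)) ρ =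
      (a 0 + a 1 + a 2 + a 3) ⬝ᵥ (Matrix.of (corr ρ) *ᵥ b 0) +
      (a 0 + a 1 - a 2 - a 3) ⬝ᵥ (Matrix.of (corr ρ) *ᵥ b 1) +
      (a 0 - a 1 + a 2 - a 3) ⬝ᵥ (Matrix.of (corr ρ) *ᵥ b 2) := by
  simp only [elegantValue, ← blochObservable_add, ← blochObservable_sub, Matrix.add_mul,
    Matrix.trace_add, Complex.add_re, trace_kronecker_blochObservable]

/-- Every real square matrix maps some orthonormal basis to an orthogonal family. -/
theorem exists_orthonormal_map_orthogonal {n : Type*} [Fintype n] [DecidableEq n]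
    (T : Matrix n n ℝ) :
    ∃ b : n → n → ℝ, (∀ k, b k ⬝ᵥ b k = 1) ∧
      (∀ k l, k ≠ l → (T *ᵥ b k) ⬝ᵥ (T *ᵥ b l) = 0) ∧
      ∑ k, (T *ᵥ b k) ⬝ᵥ (T *ᵥ b k) = ∑ i, ∑ j, T i j ^ 2 := by
  have hM : (Tᵀ * T).IsHermitian := by
    simpa using Matrix.isHermitian_conjTranspose_mul_self T
  set U : Matrix n n ℝ := (hM.eigenvectorUnitary : Matrix n n ℝ) with hU
  have hUU : Uᵀ * U = 1 := by
    simpa [star_eq_conjTranspose] using Unitary.coe_star_mul_self hM.eigenvectorUnitary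
  have hUU' : U * Uᵀ = 1 := mul_eq_one_comm.mp hUU
  have hdiag : (T * U)ᵀ * (T * U) = diagonal hM.eigenvalues := by
    have h := hM.conjStarAlgAut_star_eigenvectorUnitary
    rw [Unitary.conjStarAlgAut_star_apply] at h
    simpa [star_eq_conjTranspose, ← hU, Matrix.mul_assoc, Function.comp_def] using h
  have hgram (k l : n) : (T *ᵥ U.col k) ⬝ᵥ (T *ᵥ U.col l) = ((T * U)ᵀ * (T * U)) k l := rfl
  refine ⟨U.col, fun k => ?_, fun k l hkl => ?_, ?_⟩
  · have := congrFun (congrFun hUU k) k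
    rwa [Matrix.one_apply_eq] at this
  · rw [hgram, hdiag, diagonal_apply_ne _ hkl]
  · calc ∑ k, (T *ᵥ U.col k) ⬝ᵥ (T *ᵥ U.col k) = ((T * U)ᵀ * (T * U)).trace := rfl
      _ = (T * Tᵀ).trace := by
        rw [trace_mul_comm, transpose_mul, Matrix.mul_assoc, ← Matrix.mul_assoc U, hUU',
          Matrix.one_mul]
      _ = _ := by simp [Matrix.trace, Matrix.mul_apply, sq]

/-- For pairwise orthogonal `p`, `q`, `s` with total squared length `r ^ 2`, the normalized
vectors `(p ± q ± s) / r` realize the value `4 * r`. -/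
theorem exists_unit_vectors_sum_dotProduct_eq {n : Type*} [Fintype n] {p q s : n → ℝ} {r : ℝ}
    (hr : 0 < r) (hpq : p ⬝ᵥ q = 0) (hps : p ⬝ᵥ s = 0) (hqs : q ⬝ᵥ s = 0)
    (hsum : p ⬝ᵥ p + q ⬝ᵥ q + s ⬝ᵥ s = r ^ 2) :
    ∃ a : Fin 4 → n → ℝ, (∀ x, a x ⬝ᵥ a x = 1) ∧
      (a 0 + a 1 + a 2 + a 3) ⬝ᵥ p + (a 0 + a 1 - a 2 - a 3) ⬝ᵥ q +
        (a 0 - a 1 + a 2 - a 3) ⬝ᵥ s = 4 * r := by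
  have hqp : q ⬝ᵥ p = 0 := dotProduct_comm p q ▸ hpq
  have hsp : s ⬝ᵥ p = 0 := dotProduct_comm p s ▸ hps
  have hsq : s ⬝ᵥ q = 0 := dotProduct_comm q s ▸ hqs
  refine ⟨![r⁻¹ • (p + q + s), r⁻¹ • (p + q - s), r⁻¹ • (p - q + s), r⁻¹ • (p - q - s)],
    fun x => ?_, ?_⟩
  · fin_cases x <;>
    · simp [add_dotProduct, dotProduct_add, sub_dotProduct, dotProduct_sub,
        hpq, hps, hqs, hqp, hsp, hsq]
      field_simp
      linear_combination hsum
  · simp [add_dotProduct, sub_dotProduct, hpq, hps, hqs, hqp, hsp, hsq]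
    field_simp
    linear_combination 4 * hsum

/-- if some correlation coefficient of `ρ` is nonzero, then the bound
`4·√(Σ_{i,j} t_{ij}²)` is attained by suitable dichotomic observables. -/
theorem elegant_value_attains_corr_bound
    (ρ : Matrix ((Fin 2) × (Fin 2)) ((Fin 2) × (Fin 2)) ℂ) (hρ : IsDensity ρ)
    (ht : ∃ i j : Fin 3, corr ρ i j ≠ 0) :
    ∃ (A : Fin 4 → Matrix (Fin 2) (Fin 2) ℂ) (B : Fin 3 → Matrix (Fin 2) (Fin 2) ℂ),
      (∀ x, IsDichotomic (A x)) ∧ (∀ y, IsDichotomic (B y)) ∧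
      elegantValue A B ρ = 4 * Real.sqrt (∑ i : Fin 3, ∑ j : Fin 3, corr ρ i j ^ 2) := by
  obtain ⟨b, hb, horth, hsum⟩ := exists_orthonormal_map_orthogonal (Matrix.of (corr ρ))
  have hpos : 0 < ∑ i : Fin 3, ∑ j : Fin 3, corr ρ i j ^ 2 := by
    obtain ⟨i, j, hij⟩ := ht
    calc 0 < corr ρ i j ^ 2 := by positivity
      _ ≤ ∑ j : Fin 3, corr ρ i j ^ 2 :=
        Finset.single_le_sum (f := fun j => corr ρ i j ^ 2)
          (fun _ _ => sq_nonneg _) (Finset.mem_univ j)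
      _ ≤ _ :=
        Finset.single_le_sum (f := fun i => ∑ j : Fin 3, corr ρ i j ^ 2)
          (fun _ _ => Finset.sum_nonneg fun _ _ => sq_nonneg _) (Finset.mem_univ i)
  have hr := Real.sqrt_pos.mpr hpos
  change _ = ∑ i : Fin 3, ∑ j : Fin 3, corr ρ i j ^ 2 at hsum
  rw [← Real.sq_sqrt hpos.le, Fin.sum_univ_three] at hsum
  obtain ⟨a, ha, hval⟩ := exists_unit_vectors_sum_dotProduct_eq hr
    (horth 0 1 (by decide)) (horth 0 2 (by decide)) (horth 1 2 (by decide)) hsum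
  exact ⟨fun x => blochObservable (a x), fun y => blochObservable (b y),
    fun x => isDichotomic_blochObservable (ha x), fun y => isDichotomic_blochObservable (hb y),
    (elegantValue_blochObservable ρ a b).trans hval⟩
end
end

section
/- Let ρ be a density matrix on ℂ² ⊗ ℂ². Then there exist 2×2 unitary matrices U and V such that the correlation matrix of the locally rotated state is diagonal: Tr[((U σ_i U†) ⊗ (V σ_j V†)) ρ] = 0 for all i ≠ j with i, j ∈ {1, 2, 3}. -/
open Matrix Kronecker BigOperators
open scoped ComplexOrder

noncomputable section

theorem isHermitian_pauli (i : Fin 3) : (pauli i).IsHermitian := by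
  ext a b
  fin_cases i <;> fin_cases a <;> fin_cases b <;> simp [pauli]

theorem pauli_mul_self (i : Fin 3) : pauli i * pauli i = 1 := by
  fin_cases i <;> simp [pauli, Matrix.one_fin_two]

theorem pauli_mul_pauli_of_ne {i j : Fin 3} (hij : i ≠ j) :
    pauli i * pauli j = -(pauli j * pauli i) := by
  fin_cases i <;> fin_cases j <;> first | exact absurd rfl hij | simp [pauli]

/-- Conjugation by `c + s σ_j σ_i` rotates the Pauli matrices in the plane spanned by
`σ_i` and `σ_j`. -/
theorem exists_unitary_pauli_rotation {i j : Fin 3} (hij : i ≠ j) (θ : ℝ) :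
    ∃ W ∈ Matrix.unitaryGroup (Fin 2) ℂ,
      W * pauli i * Wᴴ = Real.cos θ • pauli i + Real.sin θ • pauli j ∧
      W * pauli j * Wᴴ = Real.cos θ • pauli j - Real.sin θ • pauli i ∧
      ∀ l, l ≠ i → l ≠ j → W * pauli l * Wᴴ = pauli l := by
  obtain ⟨c, s, h1, hc, hs⟩ : ∃ c s : ℝ, c ^ 2 + s ^ 2 = 1 ∧
      Real.cos θ = c ^ 2 - s ^ 2 ∧ Real.sin θ = 2 * s * c := by
    refine ⟨Real.cos (θ / 2), Real.sin (θ / 2), Real.cos_sq_add_sin_sq _, ?_, ?_⟩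
    · rw [← Real.cos_two_mul', mul_div_cancel₀ θ two_ne_zero]
    · rw [← Real.sin_two_mul, mul_div_cancel₀ θ two_ne_zero]
  set A := pauli i with hA
  set B := pauli j with hB
  have hAA : A * A = 1 := pauli_mul_self i
  have hBB : B * B = 1 := pauli_mul_self j
  have hBA : B * A = -(A * B) := pauli_mul_pauli_of_ne hij.symm
  have hAAx (X : Matrix (Fin 2) (Fin 2) ℂ) : A * (A * X) = X := by
    rw [← Matrix.mul_assoc, hAA, Matrix.one_mul]
  have hBBx (X : Matrix (Fin 2) (Fin 2) ℂ) : B * (B * X) = X := by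
    rw [← Matrix.mul_assoc, hBB, Matrix.one_mul]
  have hBAx (X : Matrix (Fin 2) (Fin 2) ℂ) : B * (A * X) = -(A * (B * X)) := by
    rw [← Matrix.mul_assoc, hBA, Matrix.neg_mul, Matrix.mul_assoc]
  have hstar : (c • (1 : Matrix (Fin 2) (Fin 2) ℂ) + s • (B * A))ᴴ = c • 1 + s • (A * B) := by
    simp [(isHermitian_pauli i).eq, (isHermitian_pauli j).eq, hA, hB]
  have hunit : (c • (1 : Matrix (Fin 2) (Fin 2) ℂ) + s • (B * A)) * (c • 1 + s • (A * B)) = 1 := by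
    simp only [Matrix.mul_add, Matrix.add_mul, Matrix.mul_smul, Matrix.smul_mul, Matrix.mul_one,
      Matrix.one_mul, Matrix.mul_assoc, Matrix.mul_neg, Matrix.neg_mul, hAA, hBB, hBA, hBAx,
      neg_neg]
    linear_combination (norm := module) h1 • (1 : Matrix (Fin 2) (Fin 2) ℂ)
  refine ⟨c • 1 + s • (B * A), ?_, ?_, ?_, ?_⟩
  · rw [Matrix.mem_unitaryGroup_iff, Matrix.star_eq_conjTranspose, hstar, hunit]
  · rw [hc, hs, hstar]
    simp only [Matrix.mul_add, Matrix.add_mul, Matrix.mul_smul, Matrix.smul_mul, Matrix.mul_one,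
      Matrix.one_mul, Matrix.mul_assoc, Matrix.mul_neg, Matrix.neg_mul, hBB, hBA, hAAx, hBAx,
      neg_neg]
    module
  · rw [hc, hs, hstar]
    simp only [Matrix.mul_add, Matrix.add_mul, Matrix.mul_smul, Matrix.smul_mul, Matrix.mul_one,
      Matrix.one_mul, Matrix.mul_assoc, Matrix.neg_mul, hBB, hBA, hAAx, hBAx]
    module
  · intro l hli hlj
    have hcomm : Commute (B * A) (pauli l) := by
      rw [Commute, SemiconjBy, Matrix.mul_assoc, pauli_mul_pauli_of_ne hli.symm, Matrix.mul_neg,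
        ← Matrix.mul_assoc, pauli_mul_pauli_of_ne hlj.symm, Matrix.neg_mul, neg_neg,
        Matrix.mul_assoc]
    rw [hstar, (((Commute.one_left _).smul_left c).add_left (hcomm.smul_left s)).eq,
      Matrix.mul_assoc, hunit, Matrix.mul_one]

theorem eq_zero_of_forall_mul_cos_add_mul_sin_le {β γ : ℝ}
    (h : ∀ θ : ℝ, β * Real.cos θ + γ * Real.sin θ ≤ β) : γ = 0 := by
  have hmax : IsLocalMax (fun θ : ℝ => β * Real.cos θ + γ * Real.sin θ) 0 :=
    Filter.Eventually.of_forall fun θ => by simpa using h θ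
  have hd := ((Real.hasDerivAt_cos 0).const_mul β).add ((Real.hasDerivAt_sin 0).const_mul γ)
  simpa using hmax.hasDerivAt_eq_zero hd

theorem isCompact_unitaryGroup (n : Type*) [Fintype n] [DecidableEq n] :
    IsCompact (Matrix.unitaryGroup n ℂ : Set (Matrix n n ℂ)) := by
  have hK : IsCompact (Set.univ.pi fun _ : n => Set.univ.pi fun _ : n =>
      Metric.closedBall (0 : ℂ) 1) :=
    isCompact_univ_pi fun _ => isCompact_univ_pi fun _ => isCompact_closedBall _ _
  refine hK.of_isClosed_subset (isClosed_unitary (R := Matrix n n ℂ)) fun U hU i _ j _ => ?_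
  simpa using entry_norm_bound_of_unitary hU i j

/-- The stationarity condition, with respect to rotations of the first factor, for maximizers of
a weighted sum of the diagonal correlations. -/
theorem mul_eq_mul_of_forall_unitary_le
    (B : Matrix (Fin 2) (Fin 2) ℂ →ₗ[ℝ] Matrix (Fin 2) (Fin 2) ℂ →ₗ[ℝ] ℝ) (d : Fin 3 → ℝ)
    {U V : Matrix (Fin 2) (Fin 2) ℂ} (hU : U ∈ Matrix.unitaryGroup (Fin 2) ℂ)
    (hmax : ∀ U' ∈ Matrix.unitaryGroup (Fin 2) ℂ,
      ∑ l, d l * B (U' * pauli l * U'ᴴ) (V * pauli l * Vᴴ) ≤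
        ∑ l, d l * B (U * pauli l * Uᴴ) (V * pauli l * Vᴴ))
    {i j : Fin 3} (hij : i ≠ j) :
    d i * B (U * pauli j * Uᴴ) (V * pauli i * Vᴴ) =
      d j * B (U * pauli i * Uᴴ) (V * pauli j * Vᴴ) := by
  rw [← sub_eq_zero]
  apply eq_zero_of_forall_mul_cos_add_mul_sin_le
    (β := d i * B (U * pauli i * Uᴴ) (V * pauli i * Vᴴ) +
      d j * B (U * pauli j * Uᴴ) (V * pauli j * Vᴴ))
  intro θ
  obtain ⟨W, hW, hi, hj, hl⟩ := exists_unitary_pauli_rotation hij θ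
  have hconj (l : Fin 3) : U * W * pauli l * (U * W)ᴴ = U * (W * pauli l * Wᴴ) * Uᴴ := by
    simp only [Matrix.conjTranspose_mul, Matrix.mul_assoc]
  have h := hmax (U * W) (mul_mem hU hW)
  simp only [hconj] at h
  rw [← sub_nonneg, ← Finset.sum_sub_distrib, Finset.sum_eq_add i j hij
    (fun l _ hlij => by rw [hl l hlij.1 hlij.2, sub_self]) (by simp) (by simp), hi, hj] at h
  simp only [Matrix.mul_add, Matrix.add_mul, Matrix.mul_sub, Matrix.sub_mul, Matrix.mul_smul,
    Matrix.smul_mul, map_add, map_sub, map_smul, LinearMap.add_apply, LinearMap.sub_apply,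
    LinearMap.smul_apply, smul_eq_mul] at h
  linarith

/-- Every real bilinear form on `2 × 2` matrices becomes diagonal on a pair of unitarily rotated
Pauli bases: any maximizer of a weighted sum of the diagonal entries, with distinct positive
weights, works. -/
theorem exists_unitary_forall_ne_eq_zero
    (B : Matrix (Fin 2) (Fin 2) ℂ →ₗ[ℝ] Matrix (Fin 2) (Fin 2) ℂ →ₗ[ℝ] ℝ)
    (hB : Continuous fun p : Matrix (Fin 2) (Fin 2) ℂ × Matrix (Fin 2) (Fin 2) ℂ => B p.1 p.2) :
    ∃ U ∈ Matrix.unitaryGroup (Fin 2) ℂ, ∃ V ∈ Matrix.unitaryGroup (Fin 2) ℂ,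
      ∀ i j : Fin 3, i ≠ j → B (U * pauli i * Uᴴ) (V * pauli j * Vᴴ) = 0 := by
  set d : Fin 3 → ℝ := fun l => (l : ℕ) + 1 with hd
  have hcont : Continuous fun p : Matrix (Fin 2) (Fin 2) ℂ × Matrix (Fin 2) (Fin 2) ℂ =>
      ∑ l, d l * B (p.1 * pauli l * p.1ᴴ) (p.2 * pauli l * p.2ᴴ) := by
    refine continuous_finsetSum _ fun l _ => continuous_const.mul (hB.comp (.prodMk ?_ ?_)) <;>
      fun_prop
  obtain ⟨⟨U, V⟩, hUV, hmax⟩ :=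
    ((isCompact_unitaryGroup (Fin 2)).prod (isCompact_unitaryGroup (Fin 2))).exists_isMaxOn
      (Set.Nonempty.prod ⟨1, one_mem _⟩ ⟨1, one_mem _⟩) hcont.continuousOn
  obtain ⟨hU, hV⟩ := Set.mem_prod.mp hUV
  rw [isMaxOn_iff] at hmax
  refine ⟨U, hU, V, hV, fun i j hij => ?_⟩
  have hleft := mul_eq_mul_of_forall_unitary_le B d hU
    (fun U' hU' => hmax (U', V) (Set.mk_mem_prod hU' hV)) hij
  have hright := mul_eq_mul_of_forall_unitary_le B.flip d hV
    (fun V' hV' => hmax (U, V') (Set.mk_mem_prod hU hV')) hij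
  simp only [LinearMap.flip_apply] at hright
  have hpos (l : Fin 3) : 0 < d l := by positivity
  have hne : d i - d j ≠ 0 := by
    simpa [hd, sub_eq_zero, Fin.ext_iff] using hij
  have hsq : (d i - d j) * (d i + d j) * B (U * pauli i * Uᴴ) (V * pauli j * Vᴴ) = 0 := by
    linear_combination d i * hright + d j * hleft
  exact (mul_eq_zero.mp hsq).resolve_left (mul_ne_zero hne (ne_of_gt (add_pos (hpos i) (hpos j))))

/-- The bilinear form `(X, Y) ↦ Re Tr[(X ⊗ Y) ρ]`. -/
def correlationForm (ρ : Matrix (Fin 2 × Fin 2) (Fin 2 × Fin 2) ℂ) :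
    Matrix (Fin 2) (Fin 2) ℂ →ₗ[ℝ] Matrix (Fin 2) (Fin 2) ℂ →ₗ[ℝ] ℝ :=
  LinearMap.mk₂ ℝ (fun X Y => ((X ⊗ₖ Y) * ρ).trace.re)
    (by simp [Matrix.add_kronecker, Matrix.add_mul])
    (by simp [Matrix.smul_kronecker])
    (by simp [Matrix.kronecker_add, Matrix.add_mul])
    (by simp [Matrix.kronecker_smul])

theorem trace_mul_im_eq_zero {n : Type*} [Fintype n] {A B : Matrix n n ℂ}
    (hA : A.IsHermitian) (hB : B.IsHermitian) : (A * B).trace.im = 0 := by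
  rw [← Complex.conj_eq_iff_im, starRingEnd_apply, ← Matrix.trace_conjTranspose,
    Matrix.conjTranspose_mul, hA.eq, hB.eq, Matrix.trace_mul_comm]

/-- every two-qubit state can be brought to Fano diagonal form by local
unitaries: there exist `2×2` unitaries `U, V` with
`Tr[((U σ_i U†) ⊗ (V σ_j V†)) ρ] = 0` for all `i ≠ j`. -/
theorem exists_local_unitaries_diagonalizing_correlation
    (ρ : Matrix ((Fin 2) × (Fin 2)) ((Fin 2) × (Fin 2)) ℂ) (hρ : IsDensity ρ) :
    ∃ U V : Matrix (Fin 2) (Fin 2) ℂ,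
      U ∈ Matrix.unitaryGroup (Fin 2) ℂ ∧ V ∈ Matrix.unitaryGroup (Fin 2) ℂ ∧
      ∀ i j : Fin 3, i ≠ j →
        (((U * pauli i * Uᴴ) ⊗ₖ (V * pauli j * Vᴴ)) * ρ).trace = 0 := by
  obtain ⟨U, hU, V, hV, h⟩ := exists_unitary_forall_ne_eq_zero (correlationForm ρ) <| by
    simp only [correlationForm, LinearMap.mk₂_apply, Matrix.trace, Matrix.diag, Matrix.mul_apply,
      Matrix.kroneckerMap_apply]
    fun_prop
  refine ⟨U, V, hU, hV, fun i j hij => Complex.ext (h i j hij) ?_⟩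
  refine trace_mul_im_eq_zero ?_ hρ.1.isHermitian
  rw [Matrix.IsHermitian, Matrix.conjTranspose_kronecker,
    (Matrix.isHermitian_mul_mul_conjTranspose U (isHermitian_pauli i)).eq,
    (Matrix.isHermitian_mul_mul_conjTranspose V (isHermitian_pauli j)).eq]
end
end
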